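/- Let q = 2^h be a power of 2 and F a finite field with q elements. Let W₃ = { [[x, 0, z], [0, y, 0], [z, 0, 0]] : x, y, z ∈ F } and W₄ = { [[x, 0, z], [0, y, z], [z, z, 0]] : x, y, z ∈ F } in Sym₃(F). Then the point-orbit distribution of W₄ is [2, 1, 2q−2, q²−q] (exactly 2 rank-1 points, one rank-2 point with zero diagonal, 2q−2 rank-2 points with nonzero diagonal, and q²−q rank-3 points), and moreover W₄ is not equivalent to W₃: there is no A ∈ GL(3,F) with { A M Aᵀ : M ∈ W₃ } = W₄. -/

import Mathlib

open Matrix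

/-- A *point* of a plane `W` of `PG(5,q)` (viewed as a 3-dimensional linear subspace of the
space of symmetric `3×3` matrices): a 1-dimensional linear subspace `P ≤ W`, all of whose
nonzero matrices satisfy the predicate `pred` (e.g. a rank condition). -/
def IsPointOf (F : Type) [Field F] (W P : Submodule F (Matrix (Fin 3) (Fin 3) F))
    (pred : Matrix (Fin 3) (Fin 3) F → Prop) : Prop :=
  P ≤ W ∧ Module.finrank F ↥P = 1 ∧ ∀ M ∈ P, M ≠ 0 → pred M

/-- If every nonzero matrix of `W` satisfying a scaling-invariant predicate is proportional to
exactly one of the matrices `r i`, then the points of `W` satisfying it are counted by `ι`. -/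
theorem card_isPointOf_eq {F : Type} [Field F] {ι : Type*}
    {W : Submodule F (Matrix (Fin 3) (Fin 3) F)} {pred : Matrix (Fin 3) (Fin 3) F → Prop}
    (hpred : ∀ (c : F) (M), c ≠ 0 → pred M → pred (c • M))
    (r : ι → Matrix (Fin 3) (Fin 3) F) (hW : ∀ i, r i ∈ W) (h0 : ∀ i, r i ≠ 0)
    (hr : ∀ i, pred (r i)) (hex : ∀ M ∈ W, M ≠ 0 → pred M → ∃ i, ∃ c : F, c • r i = M)
    (hinj : ∀ i j, ∀ c : F, c • r i = r j → i = j) :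
    Nat.card {P | IsPointOf F W P pred} = Nat.card ι := by
  symm
  refine Nat.card_congr (Equiv.ofBijective
    (fun i => ⟨Submodule.span F {r i}, ?_, finrank_span_singleton (h0 i), ?_⟩) ⟨?_, ?_⟩)
  · simpa using hW i
  · intro M hM hM0
    obtain ⟨c, rfl⟩ := Submodule.mem_span_singleton.1 hM
    exact hpred c _ (fun hc => hM0 (by simp [hc])) (hr i)
  · intro i j hij
    have hspan : Submodule.span F {r i} = Submodule.span F {r j} := congrArg Subtype.val hij
    have hj : r j ∈ Submodule.span F {r i} := hspan ▸ Submodule.mem_span_singleton_self (r j)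
    obtain ⟨c, hc⟩ := Submodule.mem_span_singleton.1 hj
    exact hinj i j c hc
  · rintro ⟨P, hPW, hP1, hP⟩
    obtain ⟨⟨M, hMP⟩, hM0, hM⟩ := finrank_eq_one_iff'.1 hP1
    have hM0' : M ≠ 0 := fun h => hM0 (Subtype.ext h)
    obtain ⟨i, c, hc⟩ := hex M (hPW hMP) hM0' (hP M hMP hM0')
    have hc0 : c ≠ 0 := fun h => hM0' (by simp [← hc, h])
    refine ⟨i, Subtype.ext ?_⟩
    change Submodule.span F {r i} = P
    rw [← Submodule.span_singleton_smul_eq (IsUnit.mk0 c hc0), hc]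
    refine le_antisymm (by simpa using hMP) fun N hN => ?_
    obtain ⟨d, hd⟩ := hM ⟨N, hN⟩
    exact Submodule.mem_span_singleton.2 ⟨d, congrArg Subtype.val hd⟩

/-- The general matrix of the plane `Σ₄`. -/
def sigma4Matrix {F : Type} [Field F] (x y z : F) : Matrix (Fin 3) (Fin 3) F :=
  !![x, 0, z; 0, y, z; z, z, 0]

section Sigma4Matrix

variable {F : Type} [Field F]

theorem sigma4Matrix_inj {x y z x' y' z' : F} :
    sigma4Matrix x y z = sigma4Matrix x' y' z' ↔ x = x' ∧ y = y' ∧ z = z' := by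
  constructor
  · intro h
    exact ⟨congrFun (congrFun h 0) 0, congrFun (congrFun h 1) 1, congrFun (congrFun h 0) 2⟩
  · rintro ⟨rfl, rfl, rfl⟩
    rfl

theorem smul_sigma4Matrix (c x y z : F) :
    c • sigma4Matrix x y z = sigma4Matrix (c * x) (c * y) (c * z) := by
  ext i j
  fin_cases i <;> fin_cases j <;> simp [sigma4Matrix]

theorem sigma4Matrix_eq_zero {x y z : F} :
    sigma4Matrix x y z = 0 ↔ x = 0 ∧ y = 0 ∧ z = 0 := by
  have h : (0 : Matrix (Fin 3) (Fin 3) F) = sigma4Matrix 0 0 0 := by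
    simpa using smul_sigma4Matrix (0 : F) 0 0 0
  rw [h, sigma4Matrix_inj]

theorem forall_sigma4Matrix_diag_eq_zero {x y z : F} :
    (∀ i, sigma4Matrix x y z i i = 0) ↔ x = 0 ∧ y = 0 := by
  simp [Fin.forall_fin_succ, sigma4Matrix]

theorem exists_sigma4Matrix_diag_ne_zero {x y z : F} :
    (∃ i, sigma4Matrix x y z i i ≠ 0) ↔ x ≠ 0 ∨ y ≠ 0 := by
  simp [Fin.exists_fin_succ, sigma4Matrix]

theorem rank_sigma4Matrix [CharP F 2] [DecidableEq F] (x y z : F) :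
    (sigma4Matrix x y z).rank =
      if z = 0 then (if x = 0 then 0 else 1) + (if y = 0 then 0 else 1)
      else if x = y then 2 else 3 := by
  by_cases hz : z = 0
  · have hdiag : sigma4Matrix x y z = diagonal ![x, y, 0] := by
      ext i j
      fin_cases i <;> fin_cases j <;> simp [sigma4Matrix, hz]
    rw [hdiag, rank_diagonal, Fintype.card_subtype, Finset.card_filter, Fin.sum_univ_three]
    by_cases hx : x = 0 <;> by_cases hy : y = 0 <;> simp [hx, hy, hz]
  rw [if_neg hz]
  split_ifs with hxy
  · subst hxy
    refine le_antisymm ?_ ?_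
    · have hmul : sigma4Matrix x x z = !![1, 0; 1, x / z; 0, 1] * !![x, 0, z; z, z, 0] := by
        ext i j
        fin_cases i <;> fin_cases j <;>
          simp [sigma4Matrix, Matrix.mul_apply, hz, CharTwo.add_self_eq_zero]
      rw [hmul]
      exact (rank_mul_le_left _ _).trans (by simpa using rank_le_width !![1, 0; 1, x / z; 0, 1])
    · have hdet : ((sigma4Matrix x x z).submatrix ![0, 2] ![0, 2]).det ≠ 0 := by
        rw [det_fin_two]
        simp [sigma4Matrix, hz]
      calc 2 = ((sigma4Matrix x x z).submatrix ![0, 2] ![0, 2]).rank := by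
            rw [rank_of_det_ne_zero hdet, Fintype.card_fin]
        _ ≤ _ := rank_submatrix_le _ _ _
  · have hdet : (sigma4Matrix x y z).det = -(z ^ 2 * (x - y)) := by
      rw [CharTwo.sub_eq_add, det_fin_three]
      simp [sigma4Matrix]
      ring
    refine rank_of_det_ne_zero ?_
    rw [hdet]
    exact neg_ne_zero.2 (mul_ne_zero (pow_ne_zero 2 hz) (sub_ne_zero.2 hxy))

end Sigma4Matrix

theorem rank_smul_of_ne_zero {F : Type} [Field F] {c : F} (hc : c ≠ 0)
    (M : Matrix (Fin 3) (Fin 3) F) : (c • M).rank = M.rank :=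
  rank_smul_of_mem_nonZeroDivisors M (mem_nonZeroDivisors_of_ne_zero hc)

/-- No congruence maps the plane `Σ₃` into the plane `Σ₄`. -/
theorem not_congr_sigma3_subset_sigma4 {F : Type} [Field F] (A : GL (Fin 3) F)
    (hA : ∀ x y z : F, ∃ x' y' z' : F,
      (A : Matrix (Fin 3) (Fin 3) F) * !![x, 0, z; 0, y, 0; z, 0, 0] *
        (A : Matrix (Fin 3) (Fin 3) F)ᵀ = sigma4Matrix x' y' z') : False := by
  have hdet : (A : Matrix (Fin 3) (Fin 3) F).det ≠ 0 := A.det_ne_zero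
  generalize (A : Matrix (Fin 3) (Fin 3) F) = B at hA hdet
  obtain ⟨x, y, z, hM⟩ := hA 1 0 0
  obtain ⟨u, v, w, hN⟩ := hA 0 0 1
  simp only [← Matrix.ext_iff, Fin.forall_fin_succ, Matrix.mul_apply, Fin.sum_univ_three,
    sigma4Matrix] at hM hN
  simp at hM hN
  refine hdet ?_
  rw [det_fin_three]
  grind

/-- The plane `Σ₄` has point-orbit distribution `[2, 1, 2q-2, q²-q]`, and it is not
`K`-equivalent to the plane `Σ₃`. -/
theorem sigma4_point_orbit_distribution_and_not_equiv_sigma3 (h : ℕ) (hh : 0 < h)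
    (F : Type) [Field F] [Fintype F] (hF : Fintype.card F = 2 ^ h)
    (W₃ W₄ : Submodule F (Matrix (Fin 3) (Fin 3) F))
    (hW₃ : (W₃ : Set (Matrix (Fin 3) (Fin 3) F)) =
      {M | ∃ x y z : F, M = !![x, 0, z; 0, y, 0; z, 0, 0]})
    (hW₄ : (W₄ : Set (Matrix (Fin 3) (Fin 3) F)) =
      {M | ∃ x y z : F, M = !![x, 0, z; 0, y, z; z, z, 0]}) :
    Nat.card {P | IsPointOf F W₄ P (fun M => M.rank = 1)} = 2 ∧
    Nat.card {P | IsPointOf F W₄ P (fun M => M.rank = 2 ∧ ∀ i, M i i = 0)} = 1 ∧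
    Nat.card {P | IsPointOf F W₄ P (fun M => M.rank = 2 ∧ ∃ i, M i i ≠ 0)} = 2 * 2 ^ h - 2 ∧
    Nat.card {P | IsPointOf F W₄ P (fun M => M.rank = 3)} = (2 ^ h) ^ 2 - 2 ^ h ∧
    ¬ ∃ A : GL (Fin 3) F,
        (fun M => (A : Matrix (Fin 3) (Fin 3) F) * M * (A : Matrix (Fin 3) (Fin 3) F)ᵀ) ''
          (W₃ : Set (Matrix (Fin 3) (Fin 3) F)) = (W₄ : Set (Matrix (Fin 3) (Fin 3) F)) := by
  classical
  have : Fact (Nat.Prime 2) := ⟨Nat.prime_two⟩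
  have : CharP F 2 := charP_of_card_eq_prime_pow hF
  have hmem : ∀ x y z : F, sigma4Matrix x y z ∈ W₄ := fun x y z => by
    rw [← SetLike.mem_coe, hW₄]
    exact ⟨x, y, z, rfl⟩
  have hex : ∀ M ∈ W₄, ∃ x y z : F, M = sigma4Matrix x y z := fun M hM => by
    rwa [← SetLike.mem_coe, hW₄] at hM
  have hunits : Nat.card {u : F // u ≠ 0} = 2 ^ h - 1 := by
    rw [Nat.card_eq_fintype_card, Fintype.card_subtype_compl, hF, Fintype.card_subtype_eq]
  refine ⟨?_, ?_, ?_, ?_, ?_⟩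
  · rw [card_isPointOf_eq (ι := Bool)
      (fun c M hc hM => (rank_smul_of_ne_zero hc M).trans hM)
      (fun b => if b then sigma4Matrix 1 0 0 else sigma4Matrix 0 1 0)]
    · simp
    · rintro (_ | _) <;> exact hmem _ _ _
    · rintro (_ | _) <;> simp [sigma4Matrix_eq_zero]
    · rintro (_ | _) <;> simp [rank_sigma4Matrix]
    · intro M hM hM0 hr
      obtain ⟨x, y, z, rfl⟩ := hex M hM
      rw [rank_sigma4Matrix] at hr
      have hz : z = 0 := by
        by_contra hz
        grind
      rcases eq_or_ne x 0 with hx | hx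
      · exact ⟨false, y, by simp [smul_sigma4Matrix, hx, hz]⟩
      · have hy : y = 0 := by grind
        exact ⟨true, x, by simp [smul_sigma4Matrix, hy, hz]⟩
    · rintro (_ | _) (_ | _) c <;> simp [smul_sigma4Matrix, sigma4Matrix_inj]
  · rw [card_isPointOf_eq (ι := Unit)
      (fun c M hc hM => ⟨(rank_smul_of_ne_zero hc M).trans hM.1, fun i => by simp [hM.2 i]⟩)
      (fun _ => sigma4Matrix 0 0 1)]
    · simp
    · exact fun _ => hmem _ _ _
    · simp [sigma4Matrix_eq_zero]
    · simp [rank_sigma4Matrix, forall_sigma4Matrix_diag_eq_zero]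
    · intro M hM hM0 hr
      obtain ⟨x, y, z, rfl⟩ := hex M hM
      obtain ⟨rfl, rfl⟩ := forall_sigma4Matrix_diag_eq_zero.1 hr.2
      exact ⟨(), z, by simp [smul_sigma4Matrix]⟩
    · simp
  · rw [card_isPointOf_eq (ι := {u : F // u ≠ 0} ⊕ {u : F // u ≠ 0})
      (fun c M hc hM => ⟨(rank_smul_of_ne_zero hc M).trans hM.1,
        hM.2.imp fun i hi => by simpa [hc] using hi⟩)
      (Sum.elim (fun u => sigma4Matrix 1 u.1 0) (fun u => sigma4Matrix u.1 u.1 1))]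
    · rw [Nat.card_sum, hunits]
      omega
    · rintro (u | u) <;> exact hmem _ _ _
    · rintro (u | u) <;> simp [sigma4Matrix_eq_zero]
    · rintro (⟨u, hu⟩ | ⟨u, hu⟩) <;>
        simp [rank_sigma4Matrix, exists_sigma4Matrix_diag_ne_zero, hu]
    · intro M hM hM0 hr
      obtain ⟨x, y, z, rfl⟩ := hex M hM
      rw [rank_sigma4Matrix, exists_sigma4Matrix_diag_ne_zero] at hr
      obtain ⟨hr, hxy⟩ := hr
      rcases eq_or_ne z 0 with hz | hz
      · have hx : x ≠ 0 := by grind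
        have hy : y ≠ 0 := by grind
        exact ⟨.inl ⟨y / x, div_ne_zero hy hx⟩, x, by
          simp [smul_sigma4Matrix, hz, mul_div_cancel₀, hx]⟩
      · have hxy' : x = y := by grind
        have hx : x ≠ 0 := by grind
        exact ⟨.inr ⟨x / z, div_ne_zero hx hz⟩, z, by
          simp [smul_sigma4Matrix, mul_div_cancel₀, hz, ← hxy']⟩
    · rintro (⟨u, hu⟩ | ⟨u, hu⟩) (⟨v, hv⟩ | ⟨v, hv⟩) c <;>
        simp only [Sum.elim_inl, Sum.elim_inr, smul_sigma4Matrix, sigma4Matrix_inj] <;>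
        grind
  · rw [card_isPointOf_eq (ι := (Finset.univ : Finset F).offDiag)
      (fun c M hc hM => (rank_smul_of_ne_zero hc M).trans hM)
      (fun p => sigma4Matrix p.1.1 p.1.2 1)]
    · rw [Nat.card_eq_fintype_card, Fintype.card_coe, Finset.offDiag_card, Finset.card_univ, hF, sq]
    · exact fun _ => hmem _ _ _
    · simp [sigma4Matrix_eq_zero]
    · rintro ⟨⟨x, y⟩, hxy⟩
      have hxy' : x ≠ y := by simpa using hxy
      simp [rank_sigma4Matrix, hxy']
    · intro M hM hM0 hr
      obtain ⟨x, y, z, rfl⟩ := hex M hM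
      rw [rank_sigma4Matrix] at hr
      have hz : z ≠ 0 := by grind
      have hxy : x ≠ y := by grind
      exact ⟨⟨(x / z, y / z), by simp [div_left_inj' hz, hxy]⟩, z, by
        simp [smul_sigma4Matrix, mul_div_cancel₀, hz]⟩
    · rintro ⟨⟨x, y⟩, hxy⟩ ⟨⟨x', y'⟩, hxy'⟩ c
      simp only [smul_sigma4Matrix, sigma4Matrix_inj, mul_one]
      rintro ⟨rfl, rfl, rfl⟩
      simp
  · rintro ⟨A, hA⟩
    refine not_congr_sigma3_subset_sigma4 A fun x y z => hex _ ?_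
    rw [← SetLike.mem_coe, ← hA, hW₃]
    exact ⟨_, ⟨x, y, z, rfl⟩, rfl⟩
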